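/- arXiv:1002.2651 — 2 statements merged into one kernel-verified Lean document; each statement's English description precedes it below -/
import Mathlib

section
/- Let C be a triangulated category endowed with a weight structure w. Then for any q, r ∈ ℤ and any object X ∈ C^{[q,r]}, there exist an object X^q ∈ C^{w=0} and a morphism f : X → X^q[-q] such that any cone of f belongs to C^{w≥q}. -/
open CategoryTheory CategoryTheory.Limits CategoryTheory.Pretriangulated

universe v u

namespace Paper

/-- `X` is a retract of `Y`: the identity of `X` factors through `Y`. -/
def IsRetractOf {C : Type u} [Category.{v} C] (X Y : C) : Prop :=
  ∃ (i : X ⟶ Y) (r : Y ⟶ X), i ≫ r = 𝟙 X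

variable (C : Type u) [Category.{v} C] [HasZeroObject C] [Preadditive C] [HasShift C ℤ]
  [∀ n : ℤ, (shiftFunctor C n).Additive] [Pretriangulated C]

/-- A class of objects is extension-stable if for every distinguished triangle
`A ⟶ B ⟶ C'`, if `A` and `C'` lie in the class then so does `B`. -/
def ExtStable (S : Set C) : Prop :=
  ∀ T : Triangle C, T ∈ (distTriang C) → T.obj₁ ∈ S → T.obj₃ ∈ S → T.obj₂ ∈ S

/-- A weight structure on a (pre)triangulated category `C`:
two additive, Karoubi-closed classes `le = C^{w≤0}` and `ge = C^{w≥0}` satisfying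
semi-invariance with respect to translations, orthogonality, and the existence of
weight decompositions (stated in the rotated form `X ⟶ A ⟶ B ⟶ X[1]`,
equivalent to the triangle `B[-1] ⟶ X ⟶ A ⟶ B`). -/
structure WeightStructure where
  le : Set C
  ge : Set C
  le_retract : ∀ ⦃X Y : C⦄, IsRetractOf X Y → Y ∈ le → X ∈ le
  ge_retract : ∀ ⦃X Y : C⦄, IsRetractOf X Y → Y ∈ ge → X ∈ ge
  le_add : ∀ ⦃X Y : C⦄, X ∈ le → Y ∈ le →
    ∀ b : BinaryBicone X Y, Nonempty b.IsBilimit → b.pt ∈ le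
  ge_add : ∀ ⦃X Y : C⦄, X ∈ ge → Y ∈ ge →
    ∀ b : BinaryBicone X Y, Nonempty b.IsBilimit → b.pt ∈ ge
  le_shift : ∀ ⦃X : C⦄, X ∈ le → X⟦(1 : ℤ)⟧ ∈ le
  ge_shift : ∀ ⦃X : C⦄, X ∈ ge → X⟦(-1 : ℤ)⟧ ∈ ge
  orth : ∀ ⦃X Y : C⦄, X ∈ ge → Y ∈ le → ∀ f : X ⟶ Y⟦(1 : ℤ)⟧, f = 0
  decomp : ∀ X : C, ∃ (A B : C) (f : X ⟶ A) (g : A ⟶ B) (h : B ⟶ X⟦(1 : ℤ)⟧),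
    A ∈ le ∧ B ∈ ge ∧ Triangle.mk f g h ∈ distTriang C

variable {C}

/-- `C^{w≤i} = C^{w≤0}[-i]`: the objects `X` with `X⟦i⟧ ∈ C^{w≤0}`. -/
def WeightStructure.leSet (w : WeightStructure C) (i : ℤ) : Set C := {X | X⟦i⟧ ∈ w.le}

/-- `C^{w≥i} = C^{w≥0}[-i]`: the objects `X` with `X⟦i⟧ ∈ C^{w≥0}`. -/
def WeightStructure.geSet (w : WeightStructure C) (i : ℤ) : Set C := {X | X⟦i⟧ ∈ w.ge}

/-- The heart `C^{w=0} = C^{w≤0} ∩ C^{w≥0}` of a weight structure. -/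
def WeightStructure.heart (w : WeightStructure C) : Set C := w.le ∩ w.ge

/-- `C^{w=i} = C^{w≥i} ∩ C^{w≤i}`. -/
def WeightStructure.eqSet (w : WeightStructure C) (i : ℤ) : Set C := w.geSet i ∩ w.leSet i

/-- `C^{[i,j]} = C^{w≥i} ∩ C^{w≤j}`. -/
def WeightStructure.interval (w : WeightStructure C) (i j : ℤ) : Set C :=
  w.geSet i ∩ w.leSet j

/-- A weight structure is bounded if `⋃ᵢ C^{w≤i} = Obj C = ⋃ᵢ C^{w≥i}`. -/
def WeightStructure.Bounded (w : WeightStructure C) : Prop :=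
  ∀ X : C, (∃ i : ℤ, X ∈ w.leSet i) ∧ (∃ j : ℤ, X ∈ w.geSet j)

/-- An object with no nonzero morphisms to `C^{w≤0}[1]` lies in `C^{w≥0}`. -/
theorem WeightStructure.mem_ge_of_orth (w : WeightStructure C) (A : C)
    (hA : ∀ ⦃L : C⦄, L ∈ w.le → ∀ f : A ⟶ L⟦(1 : ℤ)⟧, f = 0) : A ∈ w.ge := by
  obtain ⟨L, G, a, b, c, hL, hG, hT⟩ := w.decomp (A⟦(-1 : ℤ)⟧)
  let e : A⟦(-1 : ℤ)⟧⟦(1 : ℤ)⟧ ≅ A := (shiftFunctorCompIsoId C (-1 : ℤ) 1 (by simp)).app A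
  obtain ⟨s, hs⟩ : ∃ s : A ⟶ G, e.inv = s ≫ c :=
    Triangle.coyoneda_exact₁ _ hT e.inv (hA hL _)
  exact w.ge_retract ⟨s, c ≫ e.hom, by rw [← Category.assoc, ← hs, e.inv_hom_id]⟩ hG

/-- The class `C^{w≥0}` is extension-stable. -/
theorem WeightStructure.extStable_ge (w : WeightStructure C) : ExtStable C w.ge := by
  intro T hT h₁ h₃
  refine w.mem_ge_of_orth _ fun L hL f => ?_
  obtain ⟨g, hg⟩ := T.yoneda_exact₂ hT f (w.orth h₁ hL _)
  rw [hg, w.orth h₃ hL g, comp_zero]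

/-- Proposition 1.3.3(2): for any `q, r ∈ ℤ` and any `X ∈ C^{[q,r]}` there exist
`X^q ∈ C^{w=0}` and `f : X ⟶ X^q[-q]` such that any cone of `f` lies in `C^{w≥q}`. -/
theorem exists_heart_map_with_cone_ge (w : WeightStructure C) (q r : ℤ)
    (X : C) (hX : X ∈ w.interval q r) :
    ∃ (Xq : C) (_ : Xq ∈ w.heart) (f : X ⟶ Xq⟦(-q : ℤ)⟧),
      ∀ (Z : C) (g : Xq⟦(-q : ℤ)⟧ ⟶ Z) (h : Z ⟶ X⟦(1 : ℤ)⟧),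
        Triangle.mk f g h ∈ (distTriang C) → Z ∈ w.geSet q := by
  obtain ⟨A, B, a, b, c, hA, hB, hT⟩ := w.decomp (X⟦q⟧)
  let e : A⟦-q⟧⟦q⟧ ≅ A := (shiftFunctorCompIsoId C (-q) q (by simp)).app A
  -- the sign cancels the one in the shift of a distinguished triangle by `q`
  refine ⟨A, ⟨hA, w.extStable_ge _ hT hX.1 hB⟩,
    q.negOnePow • (shiftFunctor C q).preimage (a ≫ e.inv), fun Z g h hZ => ?_⟩
  let i := isoTriangleOfIso₁₂ _ _ (Triangle.shift_distinguished _ hZ q) hT (Iso.refl _) e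
    (by
      change (q.negOnePow • (shiftFunctor C q).map
        (q.negOnePow • (shiftFunctor C q).preimage (a ≫ e.inv))) ≫ e.hom = 𝟙 _ ≫ a
      simp [Functor.map_units_smul, smul_smul])
  have hi := Triangle.π₃.mapIso i
  exact w.ge_retract ⟨hi.hom, hi.inv, hi.hom_inv_id⟩ hB

end Paper
end

section
/- Let C be a triangulated category endowed with a weight structure w. Then for any integers i ≤ j, the class C^{[i,j]} is the smallest extension-stable subclass of the objects of C containing the union of the classes C^{w=l} for i ≤ l ≤ j. In particular, if w is bounded, then C is generated as a triangulated category by its heart Hw, i.e. C equals the smallest strictly full triangulated subcategory of C containing all objects of Hw. -/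
open CategoryTheory CategoryTheory.Limits CategoryTheory.Pretriangulated

universe v u

namespace Paper

variable (C : Type u) [Category.{v} C] [HasZeroObject C] [Preadditive C] [HasShift C ℤ]
  [∀ n : ℤ, (shiftFunctor C n).Additive] [Pretriangulated C]

variable {C}

/-- A class of objects forms a strictly full triangulated subcategory:
it contains the zero objects and is closed under isomorphisms, all shifts,
and extensions (hence under cones of morphisms between its objects). -/
def IsTriangSubcat (S : Set C) : Prop :=
  (∀ ⦃Z : C⦄, IsZero Z → Z ∈ S) ∧
  (∀ ⦃X Y : C⦄, (X ≅ Y) → X ∈ S → Y ∈ S) ∧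
  (∀ ⦃X : C⦄, X ∈ S → ∀ n : ℤ, X⟦n⟧ ∈ S) ∧
  ExtStable C S

lemma IsRetractOf.of_iso {D : Type u} [Category.{v} D] {X Y : D} (e : X ≅ Y) : IsRetractOf X Y :=
  ⟨e.hom, e.inv, e.hom_inv_id⟩

/-- In a distinguished triangle whose third morphism vanishes, the third object is a retract
of the second. -/
lemma isRetractOf_obj₂_of_mor₃_eq_zero {T : Triangle C} (hT : T ∈ distTriang C)
    (h : T.mor₃ = 0) : IsRetractOf T.obj₃ T.obj₂ := by
  obtain ⟨s, hs⟩ := Triangle.coyoneda_exact₃ T hT (𝟙 T.obj₃) (by rw [h, comp_zero])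
  exact ⟨s, T.mor₂, hs.symm⟩

/-- In a distinguished triangle whose third morphism vanishes, the first object is a retract
of the second. -/
lemma isRetractOf_obj₁_of_mor₃_eq_zero {T : Triangle C} (hT : T ∈ distTriang C)
    (h : T.mor₃ = 0) : IsRetractOf T.obj₁ T.obj₂ := by
  have h₁ : T.invRotate.mor₁ = 0 := by
    simp only [Triangle.invRotate_mor₁, h, Functor.map_zero, neg_zero, zero_comp]
    rfl
  obtain ⟨r, hr⟩ := Triangle.yoneda_exact₂ T.invRotate (inv_rot_of_distTriang _ hT) (𝟙 T.obj₁)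
    ((Category.comp_id _).trans h₁)
  exact ⟨T.mor₁, r, hr.symm⟩

/-- An extension-stable class contains every object isomorphic to an extension of its members. -/
lemma ExtStable.mem_of_iso {S : Set C} (hS : ExtStable C S) {T : Triangle C}
    (hT : T ∈ distTriang C) (h₁ : T.obj₁ ∈ S) (h₃ : T.obj₃ ∈ S) {X : C} (e : T.obj₂ ≅ X) :
    X ∈ S := by
  have comm₁ : (T.mor₁ ≫ e.hom) ≫ e.inv = 𝟙 T.obj₁ ≫ T.mor₁ := by simp
  have comm₂ : (e.inv ≫ T.mor₂) ≫ 𝟙 T.obj₃ = e.inv ≫ T.mor₂ := by simp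
  have comm₃ : T.mor₃ ≫ (𝟙 T.obj₁)⟦(1 : ℤ)⟧' = 𝟙 T.obj₃ ≫ T.mor₃ := by simp
  exact hS (Triangle.mk (T.mor₁ ≫ e.hom) (e.inv ≫ T.mor₂) T.mor₃)
    (isomorphic_distinguished _ hT _
      (Triangle.isoMk _ _ (Iso.refl T.obj₁) e.symm (Iso.refl T.obj₃) comm₁ comm₂ comm₃)) h₁ h₃

/-- The objects having a given shift in an extension-stable class form an extension-stable
class. -/
lemma ExtStable.preimage_shift {S : Set C} (hS : ExtStable C S) (n : ℤ) :
    ExtStable C {X | X⟦n⟧ ∈ S} :=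
  fun T hT h₁ h₃ => hS _ (Triangle.shift_distinguished T hT n) h₁ h₃

namespace WeightStructure

variable (w : WeightStructure C)

/-- The class `C^{w≤0}` is the right orthogonal, up to a shift, of `C^{w≥0}`. -/
lemma mem_le_iff_orth (Y : C) :
    Y ∈ w.le ↔ ∀ ⦃X : C⦄, X ∈ w.ge → ∀ f : X ⟶ Y⟦(1 : ℤ)⟧, f = 0 := by
  refine ⟨fun hY X hX f => w.orth hX hY f, fun h => ?_⟩
  obtain ⟨A, B, f, g, δ, hA, hB, hT⟩ := w.decomp Y
  exact w.le_retract (isRetractOf_obj₁_of_mor₃_eq_zero hT (h hB δ)) hA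

/-- The class `C^{w≥0}` is the left orthogonal, up to a shift, of `C^{w≤0}`. -/
lemma mem_ge_iff_orth (X : C) :
    X ∈ w.ge ↔ ∀ ⦃Y : C⦄, Y ∈ w.le → ∀ f : X ⟶ Y⟦(1 : ℤ)⟧, f = 0 := by
  refine ⟨fun hX Y hY f => w.orth hX hY f, fun h => ?_⟩
  obtain ⟨A, B, f, g, δ, hA, hB, hT⟩ := w.decomp (X⟦(-1 : ℤ)⟧)
  let e : X⟦(-1 : ℤ)⟧⟦(1 : ℤ)⟧ ≅ X := (shiftEquiv C (1 : ℤ)).counitIso.app X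
  have he : f⟦(1 : ℤ)⟧' = 0 := by
    rw [← cancel_epi e.inv, comp_zero]
    exact h hA _
  have hrot := rot_of_distTriang _ hT
  have hret := isRetractOf_obj₂_of_mor₃_eq_zero hrot (neg_eq_zero.2 he)
  exact w.ge_retract (IsRetractOf.of_iso e.symm) (w.ge_retract hret hB)

lemma extStable_le : ExtStable C w.le := by
  intro T hT h₁ h₃
  rw [mem_le_iff_orth]
  intro X hX f
  obtain ⟨g, rfl⟩ := Triangle.coyoneda_exact₂ _ (Triangle.shift_distinguished T hT 1) f
    (w.orth hX h₃ _)
  exact (congrArg (· ≫ _) (w.orth hX h₁ g)).trans zero_comp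

lemma extStable_ge_s2 : ExtStable C w.ge := by
  intro T hT h₁ h₃
  rw [mem_ge_iff_orth]
  intro Y hY f
  obtain ⟨g, rfl⟩ := Triangle.yoneda_exact₂ T hT f (w.orth h₁ hY _)
  rw [w.orth h₃ hY g, comp_zero]

lemma extStable_leSet (n : ℤ) : ExtStable C (w.leSet n) := w.extStable_le.preimage_shift n

lemma extStable_geSet (n : ℤ) : ExtStable C (w.geSet n) := w.extStable_ge_s2.preimage_shift n

lemma extStable_interval (i j : ℤ) : ExtStable C (w.interval i j) := fun T hT h₁ h₃ =>
  ⟨w.extStable_geSet i T hT h₁.1 h₃.1, w.extStable_leSet j T hT h₁.2 h₃.2⟩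

lemma mem_le_iff_of_iso {X Y : C} (e : X ≅ Y) : X ∈ w.le ↔ Y ∈ w.le :=
  ⟨w.le_retract (.of_iso e.symm), w.le_retract (.of_iso e)⟩

lemma mem_ge_iff_of_iso {X Y : C} (e : X ≅ Y) : X ∈ w.ge ↔ Y ∈ w.ge :=
  ⟨w.ge_retract (.of_iso e.symm), w.ge_retract (.of_iso e)⟩

lemma shift_mem_leSet_iff (X : C) {a b n : ℤ} (h : a + b = n) :
    X⟦a⟧ ∈ w.leSet b ↔ X ∈ w.leSet n :=
  w.mem_le_iff_of_iso ((shiftFunctorAdd' C a b n h).app X).symm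

lemma shift_mem_geSet_iff (X : C) {a b n : ℤ} (h : a + b = n) :
    X⟦a⟧ ∈ w.geSet b ↔ X ∈ w.geSet n :=
  w.mem_ge_iff_of_iso ((shiftFunctorAdd' C a b n h).app X).symm

lemma mem_leSet_zero_iff (X : C) : X ∈ w.leSet 0 ↔ X ∈ w.le :=
  w.mem_le_iff_of_iso ((shiftFunctorZero C ℤ).app X)

lemma mem_geSet_zero_iff (X : C) : X ∈ w.geSet 0 ↔ X ∈ w.ge :=
  w.mem_ge_iff_of_iso ((shiftFunctorZero C ℤ).app X)

lemma leSet_mono : Monotone w.leSet :=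
  monotone_int_of_le_succ fun i X hX =>
    (w.mem_le_iff_of_iso ((shiftFunctorAdd' C i 1 (i + 1) rfl).app X)).2 (w.le_shift hX)

lemma geSet_anti : Antitone w.geSet :=
  antitone_int_of_succ_le fun i X hX =>
    (w.mem_ge_iff_of_iso ((shiftFunctorAdd' C (i + 1) (-1) i (by simp)).app X)).2
      (w.ge_shift hX)

/-- A weight decomposition at level `i`, with the decomposed object in the middle up to
isomorphism. -/
lemma exists_triangle_geSet_leSet (X : C) (i : ℤ) :
    ∃ T ∈ distTriang C, Nonempty (T.obj₂ ≅ X) ∧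
      T.obj₁ ∈ w.geSet (i + 1) ∧ T.obj₃ ∈ w.leSet i := by
  obtain ⟨A, B, f, g, δ, hA, hB, hT⟩ := w.decomp (X⟦i⟧)
  refine ⟨_, inv_rot_of_distTriang _ (Triangle.shift_distinguished _ hT (-i)),
    ⟨((shiftEquiv C i).unitIso.app X).symm⟩, ?_, ?_⟩
  · exact (w.shift_mem_geSet_iff _ (by ring)).2
      ((w.shift_mem_geSet_iff B (neg_add_cancel i)).2 ((w.mem_geSet_zero_iff B).2 hB))
  · exact (w.shift_mem_leSet_iff A (neg_add_cancel i)).2 ((w.mem_leSet_zero_iff A).2 hA)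

/-- An object of `C^{[i,j]}` with `i < j` is an extension of an object of `C^{w=i}` by an
object of `C^{[i+1,j]}`. -/
lemma exists_triangle_of_mem_interval {X : C} {i j : ℤ} (hij : i < j)
    (hX : X ∈ w.interval i j) :
    ∃ T ∈ distTriang C, Nonempty (T.obj₂ ≅ X) ∧
      T.obj₁ ∈ w.interval (i + 1) j ∧ T.obj₃ ∈ w.eqSet i := by
  obtain ⟨T, hT, ⟨e⟩, h₁, h₃⟩ := w.exists_triangle_geSet_leSet X i
  have h₂ge : T.obj₂ ∈ w.geSet i :=
    (w.mem_ge_iff_of_iso ((shiftFunctor C i).mapIso e)).2 hX.1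
  have h₂le : T.obj₂ ∈ w.leSet j :=
    (w.mem_le_iff_of_iso ((shiftFunctor C j).mapIso e)).2 hX.2
  refine ⟨T, hT, ⟨e⟩, ⟨h₁, ?_⟩, ?_, h₃⟩
  · exact w.extStable_leSet j _ (inv_rot_of_distTriang _ hT)
      ((w.shift_mem_leSet_iff T.obj₃ (neg_add_eq_sub 1 j)).2
        (w.leSet_mono (by lia : i ≤ j - 1) h₃)) h₂le
  · exact w.extStable_geSet i _ (rot_of_distTriang _ hT) h₂ge
      ((w.shift_mem_geSet_iff T.obj₁ (add_comm 1 i)).2 h₁)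

lemma eqSet_subset_interval {i j l : ℤ} (hil : i ≤ l) (hlj : l ≤ j) :
    w.eqSet l ⊆ w.interval i j :=
  fun _ hX => ⟨w.geSet_anti hil hX.1, w.leSet_mono hlj hX.2⟩

lemma interval_subset_of_extStable {i j : ℤ} (hij : i ≤ j) {S : Set C} (hS : ExtStable C S)
    (h : ∀ l : ℤ, i ≤ l → l ≤ j → w.eqSet l ⊆ S) : w.interval i j ⊆ S := by
  induction i, hij using Int.leInductionDown with
  | base => exact h j le_rfl le_rfl
  | pred i hij ih =>
    intro X hX
    obtain ⟨T, hT, ⟨e⟩, h₁, h₃⟩ := w.exists_triangle_of_mem_interval (by lia) hX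
    rw [sub_add_cancel] at h₁
    exact hS.mem_of_iso hT (ih (fun l hl => h l (by lia)) h₁) (h _ le_rfl (by lia) h₃) e

end WeightStructure

/-- Proposition 1.3.3(3): for `i ≤ j`, the class `C^{[i,j]}` is the smallest
extension-stable subclass of `Obj C` containing `⋃_{i ≤ l ≤ j} C^{w=l}`.
In particular, if `w` is bounded then `C` is generated by its heart `Hw`, i.e.
every object of `C` lies in every strictly full triangulated subcategory of `C`
containing the heart. -/
theorem interval_smallest_extStable_and_heart_generates (w : WeightStructure C) :
    (∀ i j : ℤ, i ≤ j →
      ExtStable C (w.interval i j) ∧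
      (∀ l : ℤ, i ≤ l → l ≤ j → w.eqSet l ⊆ w.interval i j) ∧
      (∀ S : Set C, ExtStable C S → (∀ l : ℤ, i ≤ l → l ≤ j → w.eqSet l ⊆ S) →
        w.interval i j ⊆ S)) ∧
    (w.Bounded → ∀ (X : C) (S : Set C), IsTriangSubcat S → w.heart ⊆ S → X ∈ S) := by
  refine ⟨fun i j hij => ⟨w.extStable_interval i j,
    fun l hil hlj => w.eqSet_subset_interval hil hlj,
    fun S hS h => w.interval_subset_of_extStable hij hS h⟩, ?_⟩
  rintro hw X S ⟨-, hiso, hshift, hext⟩ hheart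
  obtain ⟨⟨a, ha⟩, ⟨b, hb⟩⟩ := hw X
  refine w.interval_subset_of_extStable (min_le_left a b) hext (fun l _ _ Y hY => ?_)
    ⟨w.geSet_anti (min_le_right a b) hb, ha⟩
  exact hiso ((shiftEquiv C l).unitIso.app Y).symm (hshift (hheart ⟨hY.2, hY.1⟩) (-l))

end Paper
end
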